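/- Let c, d : ℝ² → ℝ be smooth functions of (θ, ψ) satisfying Condition A (2π-periodicity in ψ) and Condition B (∫₀^{2π} c(0,ψ) dψ = 0 and ∫₀^{2π} c(π,ψ) dψ = 0). Define on (0,π) × ℝ the functions l = ∂_θ c + 2c·cot θ + csc θ·∂_ψ d, l̄ = ∂_θ d + 2d·cot θ − csc θ·∂_ψ c, and G = ∂_θ l + l·cot θ + csc θ·∂_ψ l̄. Let p ∈ ℝ and let M : (0,π) × ℝ → ℝ be the function M(θ,ψ) = p/2 + G(θ,ψ)/2 (i.e. the modified mass aspect 𝓜 = M − G/2 is the constant p/2). Then (1/(4π)) ∫₀^{π} ( ∫₀^{2π} M(θ,ψ) dψ ) sin θ dθ = p/2, and for each i = 1,2,3, (1/(4π)) ∫₀^{π} ( ∫₀^{2π} M(θ,ψ) n^i(θ,ψ) dψ ) sin θ dθ = 0, where n¹ = sin θ cos ψ, n² = sin θ sin ψ, n³ = cos θ. -/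

import Mathlib

open Real MeasureTheory

/-- `l = ∂_θ c + 2 c cot θ + csc θ ∂_ψ d`. -/
noncomputable def lfun (c d : ℝ → ℝ → ℝ) (θ ψ : ℝ) : ℝ :=
  deriv (fun t => c t ψ) θ + 2 * c θ ψ * (Real.cos θ / Real.sin θ)
    + (Real.sin θ)⁻¹ * deriv (fun s => d θ s) ψ

/-- `l̄ = ∂_θ d + 2 d cot θ − csc θ ∂_ψ c`. -/
noncomputable def lbarfun (c d : ℝ → ℝ → ℝ) (θ ψ : ℝ) : ℝ :=
  deriv (fun t => d t ψ) θ + 2 * d θ ψ * (Real.cos θ / Real.sin θ)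
    - (Real.sin θ)⁻¹ * deriv (fun s => c θ s) ψ

/-- `G = ∂_θ l + l cot θ + csc θ ∂_ψ l̄`. -/
noncomputable def Gfun (c d : ℝ → ℝ → ℝ) (θ ψ : ℝ) : ℝ :=
  deriv (fun t => lfun c d t ψ) θ + lfun c d θ ψ * (Real.cos θ / Real.sin θ)
    + (Real.sin θ)⁻¹ * deriv (fun s => lbarfun c d θ s) ψ

/-- The partial derivative in the first variable. -/
noncomputable def partialFst (f : ℝ → ℝ → ℝ) (θ ψ : ℝ) : ℝ := deriv (fun t => f t ψ) θ

/-- The partial derivative in the second variable. -/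
noncomputable def partialSnd (f : ℝ → ℝ → ℝ) (θ ψ : ℝ) : ℝ := deriv (fun s => f θ s) ψ

/-- The moment of `f θ` over one period against the weight `w`. -/
noncomputable def angularMoment (w : ℝ → ℝ) (f : ℝ → ℝ → ℝ) (θ : ℝ) : ℝ :=
  ∫ ψ in (0:ℝ)..(2 * π), f θ ψ * w ψ

section Partial

variable {f : ℝ → ℝ → ℝ}

lemma hasDerivAt_partialFst (hf : ContDiff ℝ (⊤ : ℕ∞) (Function.uncurry f)) (θ ψ : ℝ) :
    HasDerivAt (fun t => f t ψ) (partialFst f θ ψ) θ := by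
  have h : ContDiff ℝ (⊤ : ℕ∞) (fun t => f t ψ) :=
    hf.comp (contDiff_id.prodMk contDiff_const)
  exact (h.differentiable (by simp) θ).hasDerivAt

lemma hasDerivAt_partialSnd (hf : ContDiff ℝ (⊤ : ℕ∞) (Function.uncurry f)) (θ ψ : ℝ) :
    HasDerivAt (fun s => f θ s) (partialSnd f θ ψ) ψ := by
  have h : ContDiff ℝ (⊤ : ℕ∞) (fun s => f θ s) :=
    hf.comp (contDiff_const.prodMk contDiff_id)
  exact (h.differentiable (by simp) ψ).hasDerivAt

lemma contDiff_partialFst (hf : ContDiff ℝ (⊤ : ℕ∞) (Function.uncurry f)) :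
    ContDiff ℝ (⊤ : ℕ∞) (Function.uncurry (partialFst f)) := by
  have h : Function.uncurry (partialFst f) =
      fun x => fderiv ℝ (Function.uncurry f) x ((1 : ℝ), (0 : ℝ)) := by
    ext ⟨θ, ψ⟩
    have h1 := (hf.differentiable (by simp) (θ, ψ)).hasFDerivAt
    exact (h1.comp_hasDerivAt θ ((hasDerivAt_id θ).prodMk (hasDerivAt_const θ ψ))).deriv
  rw [h]
  exact (hf.fderiv_right (by simp)).clm_apply contDiff_const

lemma contDiff_partialSnd (hf : ContDiff ℝ (⊤ : ℕ∞) (Function.uncurry f)) :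
    ContDiff ℝ (⊤ : ℕ∞) (Function.uncurry (partialSnd f)) := by
  have h : Function.uncurry (partialSnd f) =
      fun x => fderiv ℝ (Function.uncurry f) x ((0 : ℝ), (1 : ℝ)) := by
    ext ⟨θ, ψ⟩
    have h1 := (hf.differentiable (by simp) (θ, ψ)).hasFDerivAt
    exact (h1.comp_hasDerivAt ψ ((hasDerivAt_const ψ θ).prodMk (hasDerivAt_id ψ))).deriv
  rw [h]
  exact (hf.fderiv_right (by simp)).clm_apply contDiff_const

lemma continuous_section (hf : ContDiff ℝ (⊤ : ℕ∞) (Function.uncurry f)) (θ : ℝ) :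
    Continuous (f θ) :=
  hf.continuous.comp (Continuous.prodMk_right θ)

lemma partialFst_periodic {T : ℝ} (hper : ∀ θ ψ, f θ (ψ + T) = f θ ψ) (θ ψ : ℝ) :
    partialFst f θ (ψ + T) = partialFst f θ ψ := by
  simp only [partialFst, hper]

lemma partialSnd_periodic {T : ℝ} (hper : ∀ θ ψ, f θ (ψ + T) = f θ ψ) (θ ψ : ℝ) :
    partialSnd f θ (ψ + T) = partialSnd f θ ψ := by
  simp only [partialSnd]
  rw [← deriv_comp_add_const]
  simp only [hper]

end Partial

section Moment

variable {f : ℝ → ℝ → ℝ} {w v : ℝ → ℝ}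

lemma hasDerivAt_angularMoment (hf : ContDiff ℝ (⊤ : ℕ∞) (Function.uncurry f))
    (hw : Continuous w) (θ : ℝ) :
    HasDerivAt (angularMoment w f) (angularMoment w (partialFst f) θ) θ := by
  have hf' := contDiff_partialFst hf
  have hcont : Continuous (fun x : ℝ × ℝ => partialFst f x.1 x.2 * w x.2) :=
    hf'.continuous.mul (hw.comp continuous_snd)
  obtain ⟨K, hK⟩ := ((isCompact_closedBall θ 1).prod
    (isCompact_uIcc (a := (0:ℝ)) (b := 2 * π))).exists_bound_of_continuousOn hcont.continuousOn
  refine (intervalIntegral.hasDerivAt_integral_of_dominated_loc_of_deriv_le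
    (F := fun t ψ => f t ψ * w ψ) (F' := fun t ψ => partialFst f t ψ * w ψ)
    (bound := fun _ => K) (Metric.closedBall_mem_nhds θ one_pos) ?_ ?_ ?_ ?_ ?_ ?_).2
  · exact .of_forall fun t => ((continuous_section hf t).mul hw).aestronglyMeasurable
  · exact ((continuous_section hf θ).mul hw).intervalIntegrable _ _
  · exact ((continuous_section hf' θ).mul hw).aestronglyMeasurable
  · exact .of_forall fun ψ hψ t ht => hK (t, ψ) ⟨ht, Set.uIoc_subset_uIcc hψ⟩
  · exact intervalIntegrable_const
  · exact .of_forall fun ψ _ t _ => (hasDerivAt_partialFst hf t ψ).mul_const _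

lemma continuous_angularMoment (hf : ContDiff ℝ (⊤ : ℕ∞) (Function.uncurry f))
    (hw : Continuous w) : Continuous (angularMoment w f) :=
  continuous_iff_continuousAt.2 fun θ => (hasDerivAt_angularMoment hf hw θ).continuousAt

/-- Integration by parts over a period. -/
lemma angularMoment_partialSnd (hf : ContDiff ℝ (⊤ : ℕ∞) (Function.uncurry f))
    (hper : ∀ θ ψ, f θ (ψ + 2 * π) = f θ ψ) (hw : ∀ ψ, HasDerivAt w (v ψ) ψ)
    (hv : Continuous v) (hwper : w (2 * π) = w 0) (θ : ℝ) :
    angularMoment w (partialSnd f) θ = -angularMoment v f θ := by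
  have h := intervalIntegral.integral_mul_deriv_eq_deriv_mul (a := 0) (b := 2 * π)
    (fun ψ _ => hasDerivAt_partialSnd hf θ ψ) (fun ψ _ => hw ψ)
    ((continuous_section (contDiff_partialSnd hf) θ).intervalIntegrable _ _)
    (hv.intervalIntegrable _ _)
  have h0 : f θ (2 * π) = f θ 0 := by simpa using hper θ 0
  rw [h0, hwper, sub_self, zero_sub] at h
  simp only [angularMoment]
  rw [h, neg_neg]

end Moment

section BondiCorrection

variable {c d : ℝ → ℝ → ℝ}

lemma Gfun_eq (hc : ContDiff ℝ (⊤ : ℕ∞) (Function.uncurry c))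
    (hd : ContDiff ℝ (⊤ : ℕ∞) (Function.uncurry d)) {θ : ℝ} (hθ : sin θ ≠ 0) (ψ : ℝ) :
    Gfun c d θ ψ = partialFst (partialFst c) θ ψ + 3 * (cos θ / sin θ) * partialFst c θ ψ
      - 2 * c θ ψ + (sin θ)⁻¹ * partialFst (partialSnd d) θ ψ
      + (sin θ)⁻¹ * partialSnd (partialFst d) θ ψ
      + 2 * cos θ / sin θ ^ 2 * partialSnd d θ ψ
      - (sin θ ^ 2)⁻¹ * partialSnd (partialSnd c) θ ψ := by
  have hl : HasDerivAt (fun t => lfun c d t ψ) _ θ :=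
    ((hasDerivAt_partialFst (contDiff_partialFst hc) θ ψ).add
      (((hasDerivAt_partialFst hc θ ψ).const_mul 2).mul
        ((hasDerivAt_cos θ).div (hasDerivAt_sin θ) hθ))).add
      (((hasDerivAt_sin θ).inv hθ).mul (hasDerivAt_partialFst (contDiff_partialSnd hd) θ ψ))
  have hlbar : HasDerivAt (fun s => lbarfun c d θ s) _ ψ :=
    ((hasDerivAt_partialSnd (contDiff_partialFst hd) θ ψ).add
      (((hasDerivAt_partialSnd hd θ ψ).const_mul 2).mul_const (cos θ / sin θ))).sub
      ((hasDerivAt_partialSnd (contDiff_partialSnd hc) θ ψ).const_mul (sin θ)⁻¹)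
  have hlfun : lfun c d θ ψ = partialFst c θ ψ + 2 * c θ ψ * (cos θ / sin θ)
      + (sin θ)⁻¹ * partialSnd d θ ψ := rfl
  have hdψ : deriv (fun s => d θ s) ψ = partialSnd d θ ψ := rfl
  rw [Gfun, hl.deriv, hlbar.deriv, hlfun, hdψ]
  simp only [Pi.div_apply, Pi.inv_apply]
  field_simp
  ring

lemma continuous_Gfun (hc : ContDiff ℝ (⊤ : ℕ∞) (Function.uncurry c))
    (hd : ContDiff ℝ (⊤ : ℕ∞) (Function.uncurry d)) {θ : ℝ} (hθ : sin θ ≠ 0) :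
    Continuous (Gfun c d θ) := by
  rw [funext (Gfun_eq hc hd hθ)]
  have h1 := continuous_section (contDiff_partialFst (contDiff_partialFst hc)) θ
  have h2 := continuous_section (contDiff_partialFst hc) θ
  have h3 := continuous_section hc θ
  have h4 := continuous_section (contDiff_partialFst (contDiff_partialSnd hd)) θ
  have h5 := continuous_section (contDiff_partialSnd (contDiff_partialFst hd)) θ
  have h6 := continuous_section (contDiff_partialSnd hd) θ
  have h7 := continuous_section (contDiff_partialSnd (contDiff_partialSnd hc)) θ
  fun_prop

/-- Moments of `G` against an eigenfunction `w` of `-∂_ψ²` with derivative `v`. -/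
lemma angularMoment_Gfun (hc : ContDiff ℝ (⊤ : ℕ∞) (Function.uncurry c))
    (hd : ContDiff ℝ (⊤ : ℕ∞) (Function.uncurry d))
    (hcA : ∀ θ ψ : ℝ, c θ (ψ + 2 * π) = c θ ψ) (hdA : ∀ θ ψ : ℝ, d θ (ψ + 2 * π) = d θ ψ)
    {w v : ℝ → ℝ} {k : ℝ} (hw : ∀ ψ, HasDerivAt w (v ψ) ψ)
    (hv : ∀ ψ, HasDerivAt v (-k * w ψ) ψ) (hwper : w (2 * π) = w 0) (hvper : v (2 * π) = v 0)
    {θ : ℝ} (hθ : sin θ ≠ 0) :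
    angularMoment w (Gfun c d) θ = angularMoment w (partialFst (partialFst c)) θ
      + 3 * (cos θ / sin θ) * angularMoment w (partialFst c) θ - 2 * angularMoment w c θ
      - 2 * (sin θ)⁻¹ * angularMoment v (partialFst d) θ
      - 2 * cos θ / sin θ ^ 2 * angularMoment v d θ
      + k * (sin θ ^ 2)⁻¹ * angularMoment w c θ := by
  have hwc : Continuous w := continuous_iff_continuousAt.2 fun ψ => (hw ψ).continuousAt
  have hvc : Continuous v := continuous_iff_continuousAt.2 fun ψ => (hv ψ).continuousAt
  have hint : ∀ {f : ℝ → ℝ → ℝ}, ContDiff ℝ (⊤ : ℕ∞) (Function.uncurry f) → ∀ a : ℝ,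
      IntervalIntegrable (fun ψ => a * (f θ ψ * w ψ)) volume 0 (2 * π) := fun hf a =>
    (((continuous_section hf θ).mul hwc).const_mul a).intervalIntegrable _ _
  have e1 : angularMoment w (partialSnd d) = fun θ => -angularMoment v d θ :=
    funext (angularMoment_partialSnd hd hdA hw hvc hwper)
  have e2 : angularMoment w (partialFst (partialSnd d)) θ = -angularMoment v (partialFst d) θ := by
    have h := hasDerivAt_angularMoment (contDiff_partialSnd hd) hwc θ
    rw [e1] at h
    exact h.unique (hasDerivAt_angularMoment hd hvc θ).neg
  have e3 := angularMoment_partialSnd (contDiff_partialFst hd) (partialFst_periodic hdA) hw hvc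
    hwper θ
  have e4 : angularMoment w (partialSnd (partialSnd c)) θ = -k * angularMoment w c θ := by
    rw [angularMoment_partialSnd (contDiff_partialSnd hc) (partialSnd_periodic hcA) hw hvc hwper,
      angularMoment_partialSnd hc hcA hv (hwc.const_mul _) hvper, neg_neg]
    simp only [angularMoment]
    rw [← intervalIntegral.integral_const_mul]
    congr 1
    ext ψ
    ring
  have i1 := hint (contDiff_partialFst (contDiff_partialFst hc)) 1
  have i2 := hint (contDiff_partialFst hc) (3 * (cos θ / sin θ))
  have i3 := hint hc 2
  have i4 := hint (contDiff_partialFst (contDiff_partialSnd hd)) (sin θ)⁻¹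
  have i5 := hint (contDiff_partialSnd (contDiff_partialFst hd)) (sin θ)⁻¹
  have i6 := hint (contDiff_partialSnd hd) (2 * cos θ / sin θ ^ 2)
  have i7 := hint (contDiff_partialSnd (contDiff_partialSnd hc)) (sin θ ^ 2)⁻¹
  have e : angularMoment w (Gfun c d) θ =
      1 * angularMoment w (partialFst (partialFst c)) θ
      + 3 * (cos θ / sin θ) * angularMoment w (partialFst c) θ
      - 2 * angularMoment w c θ
      + (sin θ)⁻¹ * angularMoment w (partialFst (partialSnd d)) θ
      + (sin θ)⁻¹ * angularMoment w (partialSnd (partialFst d)) θ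
      + 2 * cos θ / sin θ ^ 2 * angularMoment w (partialSnd d) θ
      - (sin θ ^ 2)⁻¹ * angularMoment w (partialSnd (partialSnd c)) θ := by
    simp only [angularMoment, ← intervalIntegral.integral_const_mul]
    rw [← intervalIntegral.integral_add i1 i2, ← intervalIntegral.integral_sub (i1.add i2) i3,
      ← intervalIntegral.integral_add ((i1.add i2).sub i3) i4,
      ← intervalIntegral.integral_add (((i1.add i2).sub i3).add i4) i5,
      ← intervalIntegral.integral_add ((((i1.add i2).sub i3).add i4).add i5) i6,
      ← intervalIntegral.integral_sub (((((i1.add i2).sub i3).add i4).add i5).add i6) i7]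
    refine intervalIntegral.integral_congr fun ψ _ => ?_
    simp only [Gfun_eq hc hd hθ]
    ring
  rw [e, e2, e3, e4, e1]
  ring

lemma integral_massAspect_mul (hc : ContDiff ℝ (⊤ : ℕ∞) (Function.uncurry c))
    (hd : ContDiff ℝ (⊤ : ℕ∞) (Function.uncurry d)) {p : ℝ} {M : ℝ → ℝ → ℝ}
    {w : ℝ → ℝ} (hw : Continuous w) {θ : ℝ} (hθ : sin θ ≠ 0)
    (hM : ∀ ψ : ℝ, M θ ψ = p / 2 + Gfun c d θ ψ / 2) (a : ℝ) :
    ∫ ψ in (0:ℝ)..(2 * π), M θ ψ * (a * w ψ) =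
      a * (p / 2 * (∫ ψ in (0:ℝ)..(2 * π), w ψ) + 1 / 2 * angularMoment w (Gfun c d) θ) := by
  have hG := continuous_Gfun hc hd hθ
  have hGw : Continuous fun ψ => 1 / 2 * (Gfun c d θ ψ * w ψ) := by fun_prop
  rw [angularMoment, ← intervalIntegral.integral_const_mul, ← intervalIntegral.integral_const_mul,
    ← intervalIntegral.integral_add ((hw.const_mul _).intervalIntegrable _ _)
      (hGw.intervalIntegrable _ _),
    ← intervalIntegral.integral_const_mul]
  refine intervalIntegral.integral_congr fun ψ _ => ?_
  simp only [hM]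
  ring

end BondiCorrection

lemma setIntegral_Ioo_eq_sub {a b : ℝ} (hab : a ≤ b) {g F F' : ℝ → ℝ}
    (hF : ∀ x, HasDerivAt F (F' x) x) (hF' : Continuous F')
    (hg : ∀ x ∈ Set.Ioo a b, g x = F' x) :
    ∫ x in Set.Ioo a b, g x = F b - F a := by
  rw [setIntegral_congr_fun measurableSet_Ioo hg, ← integral_Ioc_eq_integral_Ioo,
    ← intervalIntegral.integral_of_le hab]
  exact intervalIntegral.integral_eq_sub_of_hasDerivAt (fun x _ => hF x)
    (hF'.intervalIntegrable _ _)

/-- The moments against `sin θ * w ψ` vanish for `w` a first harmonic of the circle. -/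
lemma integral_massAspect_firstHarmonic {c d : ℝ → ℝ → ℝ}
    (hc : ContDiff ℝ (⊤ : ℕ∞) (Function.uncurry c))
    (hd : ContDiff ℝ (⊤ : ℕ∞) (Function.uncurry d))
    (hcA : ∀ θ ψ : ℝ, c θ (ψ + 2 * π) = c θ ψ) (hdA : ∀ θ ψ : ℝ, d θ (ψ + 2 * π) = d θ ψ)
    {p : ℝ} {M : ℝ → ℝ → ℝ}
    (hM : ∀ θ ∈ Set.Ioo (0:ℝ) π, ∀ ψ : ℝ, M θ ψ = p / 2 + Gfun c d θ ψ / 2)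
    {w v : ℝ → ℝ} (hw : ∀ ψ, HasDerivAt w (v ψ) ψ) (hv : ∀ ψ, HasDerivAt v (-1 * w ψ) ψ)
    (hwper : w (2 * π) = w 0) (hvper : v (2 * π) = v 0)
    (hw0 : ∫ ψ in (0:ℝ)..(2 * π), w ψ = 0) :
    ∫ θ in Set.Ioo (0:ℝ) π,
      (∫ ψ in (0:ℝ)..(2 * π), M θ ψ * (sin θ * w ψ)) * sin θ = 0 := by
  have hwc : Continuous w := continuous_iff_continuousAt.2 fun ψ => (hw ψ).continuousAt
  have hvc : Continuous v := continuous_iff_continuousAt.2 fun ψ => (hv ψ).continuousAt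
  have hA := hasDerivAt_angularMoment hc hwc
  have hA' := hasDerivAt_angularMoment (contDiff_partialFst hc) hwc
  have hB := hasDerivAt_angularMoment hd hvc
  have kA := continuous_angularMoment hc hwc
  have kA' := continuous_angularMoment (contDiff_partialFst hc) hwc
  have kA'' := continuous_angularMoment (contDiff_partialFst (contDiff_partialFst hc)) hwc
  have kB := continuous_angularMoment hd hvc
  have kB' := continuous_angularMoment (contDiff_partialFst hd) hvc
  rw [setIntegral_Ioo_eq_sub pi_pos.le (fun θ =>
    (((((hasDerivAt_sin θ).pow 2).mul (hA' θ)).add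
      (((hasDerivAt_sin θ).mul (hasDerivAt_cos θ)).mul (hA θ))).sub
      (((hasDerivAt_sin θ).const_mul 2).mul (hB θ))).const_mul (1 / 2)) (by
        simp only [Pi.pow_apply, Pi.mul_apply]; fun_prop)]
  · simp
  · intro θ hθ
    have hs : sin θ ≠ 0 := (sin_pos_of_mem_Ioo hθ).ne'
    rw [integral_massAspect_mul hc hd hwc hs (hM θ hθ), hw0,
      angularMoment_Gfun hc hd hcA hdA hw hv hwper hvper hs]
    simp only [Pi.pow_apply, Pi.mul_apply]
    field_simp
    linear_combination (-angularMoment w c θ) * sin_sq_add_cos_sq θ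

/-- If the modified mass aspect `𝓜 = M − G/2` is the constant `p/2`
(i.e. `M = p/2 + G/2`), then under Condition A and Condition B the Bondi
energy-momentum of the slice is `(p/2, 0, 0, 0)`. -/
theorem bondi_energy_momentum_of_constant_mass_aspect
    (c d : ℝ → ℝ → ℝ)
    (hc : ContDiff ℝ (⊤ : ℕ∞) (Function.uncurry c))
    (hd : ContDiff ℝ (⊤ : ℕ∞) (Function.uncurry d))
    (hcA : ∀ θ ψ : ℝ, c θ (ψ + 2 * π) = c θ ψ)
    (hdA : ∀ θ ψ : ℝ, d θ (ψ + 2 * π) = d θ ψ)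
    (hcB0 : (∫ ψ in (0:ℝ)..(2 * π), c 0 ψ) = 0)
    (hcBpi : (∫ ψ in (0:ℝ)..(2 * π), c π ψ) = 0)
    (p : ℝ) (M : ℝ → ℝ → ℝ)
    (hM : ∀ θ ∈ Set.Ioo (0:ℝ) π, ∀ ψ : ℝ, M θ ψ = p / 2 + Gfun c d θ ψ / 2) :
    (1 / (4 * π)) *
        ∫ θ in Set.Ioo (0:ℝ) π,
          (∫ ψ in (0:ℝ)..(2 * π), M θ ψ) * Real.sin θ = p / 2 ∧
      (1 / (4 * π)) *
        ∫ θ in Set.Ioo (0:ℝ) π,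
          (∫ ψ in (0:ℝ)..(2 * π), M θ ψ * (Real.sin θ * Real.cos ψ)) *
            Real.sin θ = 0 ∧
      (1 / (4 * π)) *
        ∫ θ in Set.Ioo (0:ℝ) π,
          (∫ ψ in (0:ℝ)..(2 * π), M θ ψ * (Real.sin θ * Real.sin ψ)) *
            Real.sin θ = 0 ∧
      (1 / (4 * π)) *
        ∫ θ in Set.Ioo (0:ℝ) π,
          (∫ ψ in (0:ℝ)..(2 * π), M θ ψ * Real.cos θ) * Real.sin θ = 0 := by
  have hsin : ∀ θ ∈ Set.Ioo (0:ℝ) π, sin θ ≠ 0 := fun θ hθ => (sin_pos_of_mem_Ioo hθ).ne'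
  have hC := hasDerivAt_angularMoment hc (continuous_const (y := (1:ℝ)))
  have hC' := hasDerivAt_angularMoment (contDiff_partialFst hc) (continuous_const (y := (1:ℝ)))
  have kC := continuous_angularMoment hc (continuous_const (y := (1:ℝ)))
  have kC' := continuous_angularMoment (contDiff_partialFst hc) (continuous_const (y := (1:ℝ)))
  have kC'' := continuous_angularMoment (contDiff_partialFst (contDiff_partialFst hc))
    (continuous_const (y := (1:ℝ)))
  have hC0 : angularMoment (fun _ => 1) c 0 = 0 := by simpa [angularMoment] using hcB0
  have hCpi : angularMoment (fun _ => 1) c π = 0 := by simpa [angularMoment] using hcBpi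
  have hG : ∀ θ ∈ Set.Ioo (0:ℝ) π, angularMoment (fun _ => 1) (Gfun c d) θ = _ := fun θ hθ =>
    angularMoment_Gfun hc hd hcA hdA (v := fun _ => 0) (k := 0)
      (fun ψ => hasDerivAt_const ψ (1:ℝ)) (fun ψ => by simpa using hasDerivAt_const ψ (0:ℝ))
      rfl rfl (hsin θ hθ)
  have hzero : ∀ (f : ℝ → ℝ → ℝ) (θ : ℝ), angularMoment (fun _ => 0) f θ = 0 := by
    simp [angularMoment]
  have hMint : ∀ θ ∈ Set.Ioo (0:ℝ) π, ∀ a : ℝ, ∫ ψ in (0:ℝ)..(2 * π), M θ ψ * a =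
      a * (p / 2 * (2 * π) + 1 / 2 * angularMoment (fun _ => 1) (Gfun c d) θ) := by
    intro θ hθ a
    simpa using integral_massAspect_mul hc hd (continuous_const (y := (1:ℝ))) (hsin θ hθ)
      (hM θ hθ) a
  refine ⟨?_, ?_, ?_, ?_⟩
  · rw [setIntegral_Ioo_eq_sub pi_pos.le (fun θ =>
      ((hasDerivAt_cos θ).const_mul (-(p * π))).add
        ((((hasDerivAt_sin θ).mul (hC' θ)).add
          (((hasDerivAt_cos θ).const_mul 2).mul (hC θ))).const_mul (1 / 2))) (by fun_prop)]
    · simp [hC0, hCpi]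
      field_simp
      ring
    · intro θ hθ
      have hs := hsin θ hθ
      have h := hMint θ hθ 1
      simp only [mul_one, one_mul] at h
      rw [h, hG θ hθ, hzero, hzero]
      field_simp
      ring
  · rw [integral_massAspect_firstHarmonic hc hd hcA hdA hM (v := fun ψ => -sin ψ)
      hasDerivAt_cos (fun ψ => by simpa using (hasDerivAt_sin ψ).fun_neg) (by simp) (by simp)
      (by simp), mul_zero]
  · rw [integral_massAspect_firstHarmonic hc hd hcA hdA hM (v := cos)
      hasDerivAt_sin (fun ψ => by simpa using hasDerivAt_cos ψ) (by simp) (by simp)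
      (by simp), mul_zero]
  · rw [setIntegral_Ioo_eq_sub pi_pos.le (fun θ =>
      (((hasDerivAt_sin θ).pow 2).const_mul (p * π / 2)).add
        ((((hasDerivAt_cos θ).mul (((hasDerivAt_sin θ).mul (hC' θ)).add
          (((hasDerivAt_cos θ).const_mul 2).mul (hC θ)))).add
          (((hasDerivAt_sin θ).pow 2).mul (hC θ))).const_mul (1 / 2))) (by
            simp only [Pi.add_apply, Pi.pow_apply, Pi.mul_apply]; fun_prop)]
    · simp [hC0, hCpi]
    · intro θ hθ
      have hs := hsin θ hθ
      rw [hMint θ hθ, hG θ hθ, hzero, hzero]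
      simp only [Pi.add_apply, Pi.pow_apply, Pi.mul_apply]
      field_simp
      ring
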